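/- Let 0<q<1, p=q^{1/2}, and let α,β be real with α,β>−1. For each n let Q_n be the polynomial satisfying Q_n(x)=x^n·b_n^{(α,β)}(1/x) for x≠0. Then, as n→∞, Q_n converges uniformly on every compact subset of ℂ to the entire function x ↦ [(p^{β+1};p)_∞/(p^{α+β+2};p)_∞]·Σ_{k=0}^{∞} [(p^{α+1};p)_k(p^{1/2}x;p)_k/(p;p)_k]·(−p^{α+3/2+k}x;p)_∞·p^{(β+1)k}, which for each x equals (p^{β+1};p)_∞(−p^{α+3/2}x;p)_∞/(p^{α+β+2};p)_∞ times the ₂φ₁ series Σ_{k=0}^{∞} (p^{α+1};p)_k(p^{1/2}x;p)_k/((p;p)_k(−p^{α+3/2}x;p)_k)·p^{(β+1)k}. -/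

import Mathlib

open Finset Filter

/-- `rpw q t` is the complex number `q^t` (real power, `q > 0`). -/
noncomputable def rpw (q t : ℝ) : ℂ := ((q ^ t : ℝ) : ℂ)

/-- Finite q-shifted factorial `(a; qq)_n`. -/
noncomputable def qPoch (a qq : ℂ) (n : ℕ) : ℂ := ∏ j ∈ Finset.range n, (1 - a * qq ^ j)

/-- Infinite q-shifted factorial `(a; qq)_∞`. -/
noncomputable def qPochInf (a qq : ℂ) : ℂ := ∏' j : ℕ, (1 - a * qq ^ j)

/-- The additive coefficient in the three-term recurrence of the monic polynomials
`b_k^{(α,β)}` (base `p`). -/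
noncomputable def Aterm (p α β : ℝ) (k : ℕ) : ℂ :=
  ((1 - rpw p (β - α)) * (1 + rpw p (α + β + 3 + 2*(k : ℝ))) /
   ((1 - rpw p (α + β + 2 + 2*(k : ℝ))) * (1 - rpw p (α + β + 4 + 2*(k : ℝ))))) *
  rpw p (α + 3/2 + (k : ℝ))

/-- The coefficient of `b_{k-1}` in the three-term recurrence of `b_k^{(α,β)}`. -/
noncomputable def Cterm (p α β : ℝ) (k : ℕ) : ℂ :=
  (1 - rpw p (2*α + 2 + 2*(k : ℝ))) * (1 - rpw p (2*β + 2 + 2*(k : ℝ))) *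
    rpw p (α + β + 2 + 2*(k : ℝ)) /
  ((1 - rpw p (α + β + 1 + 2*(k : ℝ))) * (1 - rpw p (α + β + 2 + 2*(k : ℝ)))^2 *
   (1 - rpw p (α + β + 3 + 2*(k : ℝ))))

/-- The monic polynomials `b_k^{(α,β)}` (evaluated at `μ`). -/
noncomputable def bpoly (p α β : ℝ) : ℕ → ℂ → ℂ
  | 0 => fun _ => 1
  | 1 => fun μ => μ + Aterm p α β 0
  | (k+2) => fun μ => bpoly p α β (k+1) μ * (μ + Aterm p α β (k+1)) +
      Cterm p α β (k+1) * bpoly p α β k μ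

section QPochhammer

variable {p : ℂ}

lemma summable_norm_mul_pow (hp : ‖p‖ < 1) (a : ℂ) : Summable fun j : ℕ => ‖-(a * p ^ j)‖ := by
  simpa using (summable_geometric_of_lt_one (norm_nonneg p) hp).mul_left ‖a‖

lemma multipliable_one_sub_mul_pow (hp : ‖p‖ < 1) (a : ℂ) :
    Multipliable fun j : ℕ => 1 - a * p ^ j := by
  simpa [sub_eq_add_neg] using multipliable_one_add_of_summable (summable_norm_mul_pow hp a)

lemma tendsto_qPoch (hp : ‖p‖ < 1) (a : ℂ) :
    Tendsto (qPoch a p) atTop (nhds (qPochInf a p)) :=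
  (multipliable_one_sub_mul_pow hp a).hasProd.tendsto_prod_nat

lemma qPochInf_eq_mul (hp : ‖p‖ < 1) (a : ℂ) :
    qPochInf a p = (1 - a) * qPochInf (a * p) p := by
  have h := multipliable_one_sub_mul_pow hp (a * p)
  unfold qPochInf
  rw [tprod_eq_zero_mul' (by simpa [pow_succ', mul_assoc] using h)]
  simp [pow_succ', mul_assoc]

lemma one_sub_ne_zero_of_norm_lt_one {z : ℂ} (hz : ‖z‖ < 1) : 1 - z ≠ 0 := by
  intro h
  rw [← sub_eq_zero.mp h] at hz
  simp at hz

lemma norm_mul_pow_lt_one (hp : ‖p‖ < 1) {a : ℂ} (ha : ‖a‖ < 1) (k : ℕ) : ‖a * p ^ k‖ < 1 := by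
  rw [norm_mul, norm_pow]
  exact (mul_le_of_le_one_right (norm_nonneg _) (pow_le_one₀ (norm_nonneg _) hp.le)).trans_lt ha

lemma qPoch_ne_zero (hp : ‖p‖ < 1) {a : ℂ} (ha : ‖a‖ < 1) (n : ℕ) : qPoch a p n ≠ 0 :=
  Finset.prod_ne_zero_iff.mpr fun j _ =>
    one_sub_ne_zero_of_norm_lt_one (norm_mul_pow_lt_one hp ha j)

lemma qPochInf_ne_zero (hp : ‖p‖ < 1) {a : ℂ} (ha : ‖a‖ < 1) : qPochInf a p ≠ 0 := by
  have h := tprod_one_add_ne_zero_of_summable (f := fun j : ℕ => -(a * p ^ j))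
    (fun j => by
      simpa [sub_eq_add_neg] using one_sub_ne_zero_of_norm_lt_one (norm_mul_pow_lt_one hp ha j))
    (summable_norm_mul_pow hp a)
  simpa [qPochInf, sub_eq_add_neg] using h

lemma norm_qPoch_sub_one_le (hp : ‖p‖ < 1) (a : ℂ) (n : ℕ) :
    ‖qPoch a p n - 1‖ ≤ Real.exp (‖a‖ / (1 - ‖p‖)) - 1 := by
  have h := (Finset.range n).norm_prod_one_add_sub_one_le fun j => -(a * p ^ j)
  have hs : ∑ j ∈ Finset.range n, ‖-(a * p ^ j)‖ ≤ ‖a‖ / (1 - ‖p‖) := by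
    refine ((summable_norm_mul_pow hp a).sum_le_tsum _ fun _ _ => norm_nonneg _).trans_eq ?_
    simp [tsum_mul_left, tsum_geometric_of_lt_one (norm_nonneg p) hp, div_eq_mul_inv]
  simp only [← sub_eq_add_neg] at h
  exact h.trans (sub_le_sub_right (Real.exp_le_exp.mpr hs) 1)

lemma norm_qPochInf_sub_one_le (hp : ‖p‖ < 1) (a : ℂ) :
    ‖qPochInf a p - 1‖ ≤ Real.exp (‖a‖ / (1 - ‖p‖)) - 1 :=
  le_of_tendsto ((tendsto_qPoch hp a).sub_const 1).norm
    (Eventually.of_forall (norm_qPoch_sub_one_le hp a))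

lemma norm_le_exp_of_norm_sub_one_le {z : ℂ} {s t : ℝ} (h : ‖z - 1‖ ≤ Real.exp s - 1)
    (hst : s ≤ t) : ‖z‖ ≤ Real.exp t := by
  have h1 : ‖z‖ ≤ ‖z - 1‖ + ‖(1 : ℂ)‖ := by simpa using norm_add_le (z - 1) 1
  rw [norm_one] at h1
  linarith [Real.exp_le_exp.mpr hst]

lemma norm_qPoch_le (hp : ‖p‖ < 1) {a : ℂ} {R : ℝ} (ha : ‖a‖ ≤ R) (n : ℕ) :
    ‖qPoch a p n‖ ≤ Real.exp (R / (1 - ‖p‖)) :=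
  norm_le_exp_of_norm_sub_one_le (norm_qPoch_sub_one_le hp a n)
    (div_le_div_of_nonneg_right ha (sub_nonneg.mpr hp.le))

lemma norm_qPochInf_le (hp : ‖p‖ < 1) {a : ℂ} {R : ℝ} (ha : ‖a‖ ≤ R) :
    ‖qPochInf a p‖ ≤ Real.exp (R / (1 - ‖p‖)) :=
  norm_le_exp_of_norm_sub_one_le (norm_qPochInf_sub_one_le hp a)
    (div_le_div_of_nonneg_right ha (sub_nonneg.mpr hp.le))

lemma tendsto_qPochInf_one (hp : ‖p‖ < 1) {ι : Type*} {l : Filter ι} {a : ι → ℂ}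
    (ha : Tendsto a l (nhds 0)) : Tendsto (fun i => qPochInf (a i) p) l (nhds 1) := by
  rw [tendsto_iff_norm_sub_tendsto_zero]
  refine squeeze_zero (fun _ => norm_nonneg _) (fun i => norm_qPochInf_sub_one_le hp (a i)) ?_
  have h : Tendsto (fun i => Real.exp (‖a i‖ / (1 - ‖p‖)) - 1) l
      (nhds (Real.exp (‖(0 : ℂ)‖ / (1 - ‖p‖)) - 1)) :=
    ((Real.continuous_exp.tendsto _).comp (ha.norm.div_const _)).sub_const 1
  simpa using h

lemma exists_norm_inv_qPoch_le (hp : ‖p‖ < 1) : ∃ M, ∀ n, ‖(qPoch p p n)⁻¹‖ ≤ M := by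
  have h := ((tendsto_qPoch hp p).inv₀ (qPochInf_ne_zero hp hp)).norm.bddAbove_range
  obtain ⟨M, hM⟩ := h
  exact ⟨M, fun n => hM ⟨n, rfl⟩⟩

end QPochhammer

section LimitFunction

variable {p : ℂ}

/-- The summand of the series `∑ (a;p)_k (y;p)_k / (p;p)_k (-a y p^k;p)_∞ b^k`. -/
noncomputable def qTerm (a b p y : ℂ) (k : ℕ) : ℂ :=
  qPoch a p k * qPoch y p k / qPoch p p k * qPochInf (-(a * y * p ^ k)) p * b ^ k

/-- The normalized series `(b;p)_∞ / (ab;p)_∞ ∑ (a;p)_k (y;p)_k / (p;p)_k (-a y p^k;p)_∞ b^k`. -/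
noncomputable def qLimit (a b p y : ℂ) : ℂ :=
  qPochInf b p / qPochInf (a * b) p * ∑' k, qTerm a b p y k

lemma exists_norm_coeff_le (hp : ‖p‖ < 1) (R : ℝ) :
    ∃ M, ∀ a y z : ℂ, ‖a‖ ≤ 1 → ‖y‖ ≤ R → ‖z‖ ≤ R → ∀ k,
      ‖qPoch a p k * qPoch y p k / qPoch p p k * qPochInf z p‖ ≤ M := by
  obtain ⟨M, hM⟩ := exists_norm_inv_qPoch_le hp
  have hM0 : 0 ≤ M := (norm_nonneg _).trans (hM 0)
  refine ⟨Real.exp (1 / (1 - ‖p‖)) * Real.exp (R / (1 - ‖p‖)) * M * Real.exp (R / (1 - ‖p‖)),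
    fun a y z ha hy hz k => ?_⟩
  rw [div_eq_mul_inv, norm_mul, norm_mul, norm_mul]
  gcongr
  · exact norm_qPoch_le hp ha k
  · exact norm_qPoch_le hp hy k
  · exact hM k
  · exact norm_qPochInf_le hp hz

lemma norm_neg_mul_mul_pow_le (hp : ‖p‖ < 1) {a y : ℂ} {R : ℝ} (ha : ‖a‖ ≤ 1) (hy : ‖y‖ ≤ R)
    (k : ℕ) : ‖-(a * y * p ^ k)‖ ≤ R := by
  rw [norm_neg, norm_mul, norm_mul, norm_pow]
  calc ‖a‖ * ‖y‖ * ‖p‖ ^ k ≤ 1 * R * 1 := by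
        have := (norm_nonneg y).trans hy
        gcongr
        exact pow_le_one₀ (norm_nonneg _) hp.le
    _ = R := by ring

lemma exists_norm_qTerm_le (hp : ‖p‖ < 1) (R : ℝ) :
    ∃ M, ∀ a b y : ℂ, ‖a‖ ≤ 1 → ‖y‖ ≤ R → ∀ k, ‖qTerm a b p y k‖ ≤ M * ‖b‖ ^ k := by
  obtain ⟨M, hM⟩ := exists_norm_coeff_le hp R
  refine ⟨M, fun a b y ha hy k => ?_⟩
  rw [qTerm, norm_mul, norm_pow]
  gcongr
  exact hM a y _ ha hy (norm_neg_mul_mul_pow_le hp ha hy k) k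

lemma summable_qTerm (hp : ‖p‖ < 1) {a b : ℂ} (ha : ‖a‖ < 1) (hb : ‖b‖ < 1) (y : ℂ) :
    Summable (qTerm a b p y) := by
  obtain ⟨M, hM⟩ := exists_norm_qTerm_le hp ‖y‖
  exact .of_norm_bounded ((summable_geometric_of_lt_one (norm_nonneg b) hb).mul_left M)
    (hM a b y ha.le le_rfl)

lemma qPoch_succ (a p : ℂ) (k : ℕ) : qPoch a p (k + 1) = qPoch a p k * (1 - a * p ^ k) :=
  Finset.prod_range_succ _ _

lemma one_sub_mul_qPoch_mul (a p : ℂ) (k : ℕ) :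
    (1 - a) * qPoch (a * p) p k = qPoch a p k * (1 - a * p ^ k) := by
  rw [← qPoch_succ, qPoch, qPoch, Finset.prod_range_succ']
  simp [pow_succ', mul_assoc, mul_comm]

/-- The rational part of the certificate which telescopes the contiguous relation of `qTerm`. -/
noncomputable def contiguousCert (a b p y P : ℂ) : ℂ :=
  -((1 - a * b * p ^ 2) * (1 - a) * (1 - a * p)) +
    (1 - a * p) * ((1 - a * b) * (1 - a * b * p ^ 2) * a +
      y * (a ^ 2 + b * (a * p - a ^ 2 + a ^ 2 * p ^ 2 - a ^ 3 * p ^ 2) - a ^ 2 * p * b ^ 2)) * P -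
    (1 - a * b) * (1 - a ^ 2 * p ^ 2) * a ^ 2 * b * p * y * P ^ 2

lemma contiguousCert_identity (a b p y P : ℂ) :
    (1 - b) * (1 - a * b * p ^ 2) * (1 - a) * (1 - a * p) *
        ((1 + a * y * P) * (1 + a * y * P * p)) -
      (1 - a * b * p) * ((1 - a * b) * (1 - a * b * p ^ 2) + (a - b) * (1 + a * b * p) * y) *
        (1 - a * p) * ((1 - a * P) * P * (1 + a * y * P * p)) -
      (1 - a * b) * (1 - a ^ 2 * p ^ 2) * (1 + b * p) * a * b * p * y ^ 2 *
        ((1 - a * P) * (1 - a * P * p) * P ^ 2) =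
      contiguousCert a b p y (P * p) * ((1 - a * P) * (1 - y * P) * b) -
        contiguousCert a b p y P * ((1 - P) * (1 + a * y * P * p)) := by
  unfold contiguousCert
  ring

/-- The sequence whose differences give the contiguous relation of `qTerm`. -/
noncomputable def contiguousPrim (a b p y : ℂ) (k : ℕ) : ℂ :=
  contiguousCert a b p y (p ^ k) * (1 - p ^ k) *
    (qPoch a p k * qPoch y p k / qPoch p p k * qPochInf (-(a * y * p ^ (k + 1))) p * b ^ k)

lemma contiguousPrim_sub (hp : ‖p‖ < 1) {a : ℂ} (b y : ℂ) (k : ℕ) :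
    contiguousPrim a b p y (k + 1) - contiguousPrim a b p y k =
      (1 - b) * (1 - a * b * p ^ 2) * (1 - a) * (1 - a * p) * qTerm a b p y k -
      (1 - a * b * p) * ((1 - a * b) * (1 - a * b * p ^ 2) + (a - b) * (1 + a * b * p) * y) *
        ((1 - a) * (1 - a * p)) * qTerm (a * p) (b * p) p y k -
      (1 - a * b) * (1 - a ^ 2 * p ^ 2) * (1 + b * p) * a * b * p * y ^ 2 *
        ((1 - a) * (1 - a * p)) * qTerm (a * p ^ 2) (b * p ^ 2) p y k := by
  have hP := one_sub_ne_zero_of_norm_lt_one (norm_mul_pow_lt_one hp hp k)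
  have hQ := qPoch_ne_zero hp hp k
  have hU (j : ℕ) : qPochInf (-(a * y * p ^ j)) p =
      (1 + a * y * p ^ j) * qPochInf (-(a * y * p ^ (j + 1))) p := by
    rw [qPochInf_eq_mul hp]
    ring_nf
  have h1 := one_sub_mul_qPoch_mul a p k
  have h2 : (1 - a) * (1 - a * p) * qPoch (a * p ^ 2) p k =
      qPoch a p k * (1 - a * p ^ k) * (1 - a * p ^ k * p) := by
    have := one_sub_mul_qPoch_mul (a * p) p k
    rw [show a * p ^ 2 = a * p * p by ring, mul_assoc, this, ← mul_assoc, h1]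
    ring
  have t0 : qTerm a b p y k = (1 + a * y * p ^ k) * (1 + a * y * p ^ k * p) *
      (qPoch a p k * qPoch y p k / qPoch p p k * qPochInf (-(a * y * p ^ (k + 2))) p * b ^ k) := by
    rw [qTerm, hU k, hU (k + 1)]
    ring
  have t1 : (1 - a) * qTerm (a * p) (b * p) p y k =
      (1 - a * p ^ k) * p ^ k * (1 + a * y * p ^ k * p) *
      (qPoch a p k * qPoch y p k / qPoch p p k * qPochInf (-(a * y * p ^ (k + 2))) p * b ^ k) := by
    have : a * p * y * p ^ k = a * y * p ^ (k + 1) := by ring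
    rw [qTerm, this, hU (k + 1), mul_pow]
    linear_combination (qPoch y p k / qPoch p p k * ((1 + a * y * p ^ (k + 1)) *
      qPochInf (-(a * y * p ^ (k + 2))) p) * (b ^ k * p ^ k)) * h1
  have t2 : (1 - a) * (1 - a * p) * qTerm (a * p ^ 2) (b * p ^ 2) p y k =
      (1 - a * p ^ k) * (1 - a * p ^ k * p) * (p ^ k) ^ 2 *
      (qPoch a p k * qPoch y p k / qPoch p p k * qPochInf (-(a * y * p ^ (k + 2))) p * b ^ k) := by
    have : a * p ^ 2 * y * p ^ k = a * y * p ^ (k + 2) := by ring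
    rw [qTerm, this, mul_pow, ← pow_mul, mul_comm 2 k, pow_mul]
    linear_combination (qPoch y p k / qPoch p p k *
      qPochInf (-(a * y * p ^ (k + 2))) p * (b ^ k * (p ^ k) ^ 2)) * h2
  have g0 : contiguousPrim a b p y k =
      contiguousCert a b p y (p ^ k) * ((1 - p ^ k) * (1 + a * y * p ^ k * p)) *
      (qPoch a p k * qPoch y p k / qPoch p p k * qPochInf (-(a * y * p ^ (k + 2))) p * b ^ k) := by
    rw [contiguousPrim, hU (k + 1)]
    ring
  have g1 : contiguousPrim a b p y (k + 1) =
      contiguousCert a b p y (p ^ k * p) * ((1 - a * p ^ k) * (1 - y * p ^ k) * b) *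
      (qPoch a p k * qPoch y p k / qPoch p p k * qPochInf (-(a * y * p ^ (k + 2))) p * b ^ k) := by
    rw [contiguousPrim, qPoch_succ, qPoch_succ, qPoch_succ, pow_succ p k, pow_succ b k,
      mul_comm p (p ^ k)]
    rw [mul_comm p (p ^ k)] at hP
    field_simp
  rw [g0, g1, t0]
  linear_combination (-(qPoch a p k * qPoch y p k / qPoch p p k *
      qPochInf (-(a * y * p ^ (k + 2))) p * b ^ k)) * contiguousCert_identity a b p y (p ^ k) +
    ((1 - a * b * p) * ((1 - a * b) * (1 - a * b * p ^ 2) + (a - b) * (1 + a * b * p) * y) *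
        (1 - a * p)) * t1 +
    ((1 - a * b) * (1 - a ^ 2 * p ^ 2) * (1 + b * p) * a * b * p * y ^ 2) * t2

lemma tendsto_contiguousPrim (hp : ‖p‖ < 1) {a b : ℂ} (ha : ‖a‖ < 1) (hb : ‖b‖ < 1) (y : ℂ) :
    Tendsto (contiguousPrim a b p y) atTop (nhds 0) := by
  obtain ⟨M, hM⟩ := exists_norm_coeff_le hp ‖y‖
  have hpk := tendsto_pow_atTop_nhds_zero_of_norm_lt_one hp
  have hcont : Continuous fun P => contiguousCert a b p y P * (1 - P) := by
    unfold contiguousCert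
    fun_prop
  have h1 := (hcont.tendsto 0).comp hpk
  have h2 : Tendsto (fun k => qPoch a p k * qPoch y p k / qPoch p p k *
      qPochInf (-(a * y * p ^ (k + 1))) p * b ^ k) atTop (nhds 0) := by
    refine squeeze_zero_norm (a := fun k => M * ‖b‖ ^ k) (fun k => ?_) ?_
    · rw [norm_mul, norm_pow]
      gcongr
      exact hM a y _ ha.le le_rfl (norm_neg_mul_mul_pow_le hp ha.le le_rfl _) k
    · simpa using (tendsto_pow_atTop_nhds_zero_of_lt_one (norm_nonneg b) hb).const_mul M
  have h := h1.mul h2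
  rw [mul_zero] at h
  exact h

lemma tsum_qTerm_contiguous (hp : ‖p‖ < 1) {a b : ℂ} (ha : ‖a‖ < 1) (hb : ‖b‖ < 1) (y : ℂ) :
    (1 - b) * (1 - a * b * p ^ 2) * ∑' k, qTerm a b p y k =
      (1 - a * b * p) * ((1 - a * b) * (1 - a * b * p ^ 2) + (a - b) * (1 + a * b * p) * y) *
        ∑' k, qTerm (a * p) (b * p) p y k +
      (1 - a * b) * (1 - a ^ 2 * p ^ 2) * (1 + b * p) * a * b * p * y ^ 2 *
        ∑' k, qTerm (a * p ^ 2) (b * p ^ 2) p y k := by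
  have ha1 : ‖a * p‖ < 1 := by simpa using norm_mul_pow_lt_one hp ha 1
  have hb1 : ‖b * p‖ < 1 := by simpa using norm_mul_pow_lt_one hp hb 1
  have s0 := (summable_qTerm hp ha hb y).hasSum
  have s1 := (summable_qTerm hp ha1 hb1 y).hasSum
  have s2 := (summable_qTerm hp (norm_mul_pow_lt_one hp ha 2)
    (norm_mul_pow_lt_one hp hb 2) y).hasSum
  have key := ((s0.mul_left ((1 - b) * (1 - a * b * p ^ 2) * (1 - a) * (1 - a * p))).sub
    (s1.mul_left ((1 - a * b * p) * ((1 - a * b) * (1 - a * b * p ^ 2) +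
      (a - b) * (1 + a * b * p) * y) * ((1 - a) * (1 - a * p))))).sub
    (s2.mul_left ((1 - a * b) * (1 - a ^ 2 * p ^ 2) * (1 + b * p) * a * b * p * y ^ 2 *
        ((1 - a) * (1 - a * p))))
  simp only [← contiguousPrim_sub hp b y] at key
  have hlim := key.tendsto_sum_nat
  simp only [Finset.sum_range_sub] at hlim
  have h0 : contiguousPrim a b p y 0 = 0 := by simp [contiguousPrim]
  rw [h0] at hlim
  have hz := tendsto_nhds_unique hlim (by simpa using tendsto_contiguousPrim hp ha hb y)
  have hne : (1 - a) * (1 - a * p) ≠ 0 := mul_ne_zero (one_sub_ne_zero_of_norm_lt_one ha)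
    (one_sub_ne_zero_of_norm_lt_one ha1)
  refine mul_left_cancel₀ hne ?_
  linear_combination hz

/-- The coefficient of `y` in the contiguous relation of `qLimit`. -/
noncomputable def linCoeff (a b p : ℂ) : ℂ :=
  (a - b) * (1 + a * b * p) / ((1 - a * b) * (1 - a * b * p ^ 2))

/-- The coefficient of `y ^ 2` in the contiguous relation of `qLimit`. -/
noncomputable def quadCoeff (a b p : ℂ) : ℂ :=
  (1 - a ^ 2 * p ^ 2) * (1 - b ^ 2 * p ^ 2) * (a * b * p) /
    ((1 - a * b * p) * (1 - a * b * p ^ 2) ^ 2 * (1 - a * b * p ^ 3))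

lemma norm_mul_lt_one {a b : ℂ} (ha : ‖a‖ < 1) (hb : ‖b‖ < 1) : ‖a * b‖ < 1 := by
  rw [norm_mul]
  exact mul_lt_one_of_nonneg_of_lt_one_left (norm_nonneg _) ha hb.le

lemma qLimit_contiguous (hp : ‖p‖ < 1) {a b : ℂ} (ha : ‖a‖ < 1) (hb : ‖b‖ < 1) (y : ℂ) :
    qLimit a b p y = (1 + linCoeff a b p * y) * qLimit (a * p) (b * p) p y +
      quadCoeff a b p * y ^ 2 * qLimit (a * p ^ 2) (b * p ^ 2) p y := by
  have hab := norm_mul_lt_one ha hb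
  have n0 := one_sub_ne_zero_of_norm_lt_one hab
  have n1 : 1 - a * b * p ≠ 0 := by
    simpa using one_sub_ne_zero_of_norm_lt_one (norm_mul_pow_lt_one hp hab 1)
  have n2 := one_sub_ne_zero_of_norm_lt_one (norm_mul_pow_lt_one hp hab 2)
  have n3 := one_sub_ne_zero_of_norm_lt_one (norm_mul_pow_lt_one hp hab 3)
  have m0 := one_sub_ne_zero_of_norm_lt_one hb
  have m1 : 1 - b * p ≠ 0 := by
    simpa using one_sub_ne_zero_of_norm_lt_one (norm_mul_pow_lt_one hp hb 1)
  have hU := qPochInf_ne_zero hp (norm_mul_pow_lt_one hp hab 4)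
  have eb0 := qPochInf_eq_mul hp b
  have eb1 : qPochInf (b * p) p = (1 - b * p) * qPochInf (b * p ^ 2) p := by
    rw [qPochInf_eq_mul hp]; ring_nf
  have e0 := qPochInf_eq_mul hp (a * b)
  have e1 : qPochInf (a * b * p) p = (1 - a * b * p) * qPochInf (a * b * p ^ 2) p := by
    rw [qPochInf_eq_mul hp]; ring_nf
  have e2 : qPochInf (a * b * p ^ 2) p = (1 - a * b * p ^ 2) * qPochInf (a * b * p ^ 3) p := by
    rw [qPochInf_eq_mul hp]; ring_nf
  have e3 : qPochInf (a * b * p ^ 3) p = (1 - a * b * p ^ 3) * qPochInf (a * b * p ^ 4) p := by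
    rw [qPochInf_eq_mul hp]; ring_nf
  have key := tsum_qTerm_contiguous hp ha hb y
  unfold qLimit linCoeff quadCoeff
  rw [show a * p * (b * p) = a * b * p ^ 2 by ring,
    show a * p ^ 2 * (b * p ^ 2) = a * b * p ^ 4 by ring, e0, e1, e2, e3, eb0, eb1]
  generalize qPochInf (a * b * p ^ 4) p = U at *
  generalize qPochInf (b * p ^ 2) p = V at *
  generalize (∑' k, qTerm a b p y k) = S0 at *
  generalize (∑' k, qTerm (a * p) (b * p) p y k) = S1 at *
  generalize (∑' k, qTerm (a * p ^ 2) (b * p ^ 2) p y k) = S2 at *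
  have hS : S0 = ((1 - a * b * p) *
      ((1 - a * b) * (1 - a * b * p ^ 2) + (a - b) * (1 + a * b * p) * y) * S1 +
      (1 - a * b) * (1 - a ^ 2 * p ^ 2) * (1 + b * p) * a * b * p * y ^ 2 * S2) /
      ((1 - b) * (1 - a * b * p ^ 2)) := by
    rw [eq_div_iff (mul_ne_zero m0 n2)]
    linear_combination key
  rw [hS]
  generalize hA : 1 - a * b = N0 at *
  generalize hB : 1 - a * b * p = N1 at *
  generalize hC : 1 - a * b * p ^ 2 = N2 at *
  generalize hD : 1 - a * b * p ^ 3 = N3 at *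
  generalize hE : 1 - b = M0 at *
  rw [show 1 - b ^ 2 * p ^ 2 = (1 - b * p) * (1 + b * p) by ring]
  field_simp

lemma tendsto_qLimit (hp : ‖p‖ < 1) {a b : ℂ} (ha : ‖a‖ < 1) (hb : ‖b‖ < 1) (R : ℝ) :
    Tendsto (fun i : ℕ × ℂ => qLimit (a * p ^ i.1) (b * p ^ i.1) p i.2)
      (atTop ×ˢ principal (Metric.closedBall 0 R)) (nhds 1) := by
  set l : Filter (ℕ × ℂ) := atTop ×ˢ principal (Metric.closedBall 0 R)
  have hR : ∀ᶠ i in l, ‖i.2‖ ≤ R := by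
    have := (eventually_principal.mpr fun x hx => hx :
      ∀ᶠ x in principal (Metric.closedBall (0 : ℂ) R), x ∈ Metric.closedBall (0 : ℂ) R)
    filter_upwards [this.prod_inr atTop] with i hi using by simpa using hi
  have hpn : Tendsto (fun i : ℕ × ℂ => p ^ i.1) l (nhds 0) :=
    (tendsto_pow_atTop_nhds_zero_of_norm_lt_one hp).comp tendsto_fst
  have han : Tendsto (fun i : ℕ × ℂ => a * p ^ i.1) l (nhds 0) := by simpa using hpn.const_mul a
  have hbn : Tendsto (fun i : ℕ × ℂ => b * p ^ i.1) l (nhds 0) := by simpa using hpn.const_mul b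
  have habn : Tendsto (fun i : ℕ × ℂ => a * p ^ i.1 * (b * p ^ i.1)) l (nhds 0) := by
    simpa using han.mul hbn
  have hyn : Tendsto (fun i : ℕ × ℂ => -(a * p ^ i.1 * i.2 * p ^ 0)) l (nhds 0) := by
    have : Tendsto (fun i : ℕ × ℂ => a * p ^ i.1 * i.2) l (nhds 0) :=
      han.zero_mul_isBoundedUnder_le ⟨R, by simpa using hR⟩
    simpa using this.neg
  obtain ⟨M, hM⟩ := exists_norm_qTerm_le hp R
  have hM0 : ∀ᶠ i in l, ∀ k,
      ‖qTerm (a * p ^ i.1) (b * p ^ i.1) p i.2 k‖ ≤ M * ‖b * p ^ i.1‖ ^ k := by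
    filter_upwards [hR] with i hi k
    exact hM _ _ _ (norm_mul_pow_lt_one hp ha _).le hi k
  have hsum : Tendsto (fun i : ℕ × ℂ => ∑' k, qTerm (a * p ^ i.1) (b * p ^ i.1) p i.2 k) l
      (nhds (∑' k, if k = 0 then 1 else 0)) := by
    refine tendsto_tsum_of_dominated_convergence (bound := fun k => |M| * ‖b‖ ^ k)
      ((summable_geometric_of_lt_one (norm_nonneg b) hb).mul_left |M|) (fun k => ?_) ?_
    · rcases eq_or_ne k 0 with rfl | hk
      · simpa [qTerm, qPoch] using tendsto_qPochInf_one hp hyn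
      · rw [if_neg hk]
        refine squeeze_zero_norm' (a := fun i : ℕ × ℂ => M * ‖b * p ^ i.1‖ ^ k)
          (hM0.mono fun i hi => hi k) ?_
        simpa [hk] using (hbn.norm.pow k).const_mul M
    · filter_upwards [hM0] with i hi k
      refine (hi k).trans ?_
      gcongr
      · exact le_abs_self M
      · rw [norm_mul, norm_pow]
        exact mul_le_of_le_one_right (norm_nonneg _) (pow_le_one₀ (norm_nonneg _) hp.le)
  rw [tsum_ite_eq] at hsum
  simpa [qLimit] using
    ((tendsto_qPochInf_one hp hbn).div (tendsto_qPochInf_one hp habn) one_ne_zero).mul hsum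

end LimitFunction

section Recurrence

variable {p : ℂ}

/-- The solution of the reversed three-term recurrence attached to the contiguous relation
of `qLimit`. -/
noncomputable def revPoly (a b p : ℂ) : ℕ → ℂ → ℂ
  | 0 => fun _ => 1
  | 1 => fun y => 1 + linCoeff a b p * y
  | (n + 2) => fun y =>
      revPoly a b p (n + 1) y * (1 + linCoeff (a * p ^ (n + 1)) (b * p ^ (n + 1)) p * y) +
        quadCoeff (a * p ^ n) (b * p ^ n) p * y ^ 2 * revPoly a b p n y

lemma qLimit_eq_revPoly (hp : ‖p‖ < 1) {a b : ℂ} (ha : ‖a‖ < 1) (hb : ‖b‖ < 1) (y : ℂ) (n : ℕ) :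
    qLimit a b p y =
      revPoly a b p (n + 1) y * qLimit (a * p ^ (n + 1)) (b * p ^ (n + 1)) p y +
        quadCoeff (a * p ^ n) (b * p ^ n) p * y ^ 2 * revPoly a b p n y *
          qLimit (a * p ^ (n + 2)) (b * p ^ (n + 2)) p y := by
  induction n with
  | zero => simpa [revPoly] using qLimit_contiguous hp ha hb y
  | succ n ih =>
    have h := qLimit_contiguous hp (norm_mul_pow_lt_one hp ha (n + 1))
      (norm_mul_pow_lt_one hp hb (n + 1)) y
    simp only [mul_assoc a, mul_assoc b, ← pow_succ, ← pow_add] at h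
    rw [ih, h, revPoly]
    ring

lemma norm_le_exp_of_recurrence {u s t : ℕ → ℂ}
    (hrec : ∀ n, u (n + 2) = u (n + 1) * (1 + s n) + t n * u n)
    {B S : ℝ} (h0 : ‖u 0‖ ≤ B) (h1 : ‖u 1‖ ≤ B)
    (hS : ∀ n, ∑ i ∈ Finset.range n, (‖s i‖ + ‖t i‖) ≤ S) (n : ℕ) : ‖u n‖ ≤ B * Real.exp S := by
  have hB : 0 ≤ B := (norm_nonneg _).trans h0
  have hstep : ∀ n, ‖u n‖ ≤ B * Real.exp (∑ i ∈ Finset.range n, (‖s i‖ + ‖t i‖)) ∧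
      ‖u (n + 1)‖ ≤ B * Real.exp (∑ i ∈ Finset.range n, (‖s i‖ + ‖t i‖)) := by
    intro n
    induction n with
    | zero => simpa using ⟨h0, h1⟩
    | succ n ih =>
      rw [Finset.sum_range_succ, Real.exp_add]
      set E := Real.exp (∑ i ∈ Finset.range n, (‖s i‖ + ‖t i‖))
      have hE : 0 ≤ B * E := mul_nonneg hB (Real.exp_pos _).le
      have hx := Real.add_one_le_exp (‖s n‖ + ‖t n‖)
      have hgrow : B * E * (1 + ‖s n‖ + ‖t n‖) ≤ B * (E * Real.exp (‖s n‖ + ‖t n‖)) := by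
        rw [← mul_assoc]
        gcongr
        linarith
      refine ⟨(ih.2.trans ?_).trans hgrow, ?_⟩
      · exact le_mul_of_one_le_right hE (by linarith [norm_nonneg (s n), norm_nonneg (t n)])
      · refine le_trans ?_ hgrow
        rw [hrec]
        calc ‖u (n + 1) * (1 + s n) + t n * u n‖
            ≤ ‖u (n + 1)‖ * (1 + ‖s n‖) + ‖t n‖ * ‖u n‖ := by
              refine (norm_add_le _ _).trans ?_
              rw [norm_mul, norm_mul]
              gcongr
              simpa using norm_add_le 1 (s n)
          _ ≤ (B * E) * (1 + ‖s n‖) + ‖t n‖ * (B * E) := by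
              gcongr
              exacts [ih.2, ih.1]
          _ = B * E * (1 + ‖s n‖ + ‖t n‖) := by ring
  refine (hstep n).1.trans ?_
  gcongr
  exact hS n

lemma summable_norm_pow_mul (hp : ‖p‖ < 1) {f : ℕ → ℂ} {c : ℂ}
    (hf : Tendsto f atTop (nhds c)) : Summable fun n => ‖p ^ n * f n‖ := by
  have h : (fun n => p ^ n * f n) =O[atTop] fun n => p ^ n * 1 :=
    (Asymptotics.isBigO_refl _ _).mul (hf.isBigO_one ℂ)
  refine summable_of_isBigO_nat
    (summable_geometric_of_lt_one (norm_nonneg p) hp) (g := fun n => ‖p‖ ^ n) ?_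
  simpa using h.norm_norm

lemma summable_norm_linCoeff (hp : ‖p‖ < 1) (a b : ℂ) :
    Summable fun n => ‖linCoeff (a * p ^ n) (b * p ^ n) p‖ := by
  have hcont : ContinuousAt (fun P : ℂ => (a - b) * (1 + a * P * (b * P) * p) /
      ((1 - a * P * (b * P)) * (1 - a * P * (b * P) * p ^ 2))) 0 := by
    refine ContinuousAt.div (by fun_prop) (by fun_prop) (by simp)
  refine (summable_norm_pow_mul hp
    (hcont.tendsto.comp (tendsto_pow_atTop_nhds_zero_of_norm_lt_one hp))).congr fun n => ?_
  rw [linCoeff, Function.comp_apply]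
  congr 1
  ring

lemma summable_norm_quadCoeff (hp : ‖p‖ < 1) (a b : ℂ) :
    Summable fun n => ‖quadCoeff (a * p ^ n) (b * p ^ n) p‖ := by
  have hcont : ContinuousAt (fun P : ℂ =>
      (1 - (a * P) ^ 2 * p ^ 2) * (1 - (b * P) ^ 2 * p ^ 2) * (a * b * P * p) /
      ((1 - a * P * (b * P) * p) * (1 - a * P * (b * P) * p ^ 2) ^ 2 *
        (1 - a * P * (b * P) * p ^ 3))) 0 := by
    refine ContinuousAt.div (by fun_prop) (by fun_prop) (by simp)
  refine (summable_norm_pow_mul hp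
    (hcont.tendsto.comp (tendsto_pow_atTop_nhds_zero_of_norm_lt_one hp))).congr fun n => ?_
  rw [quadCoeff, Function.comp_apply]
  congr 1
  ring

lemma exists_norm_revPoly_le (hp : ‖p‖ < 1) (a b : ℂ) (R : ℝ) :
    ∃ M, ∀ n y, ‖y‖ ≤ R → ‖revPoly a b p n y‖ ≤ M := by
  have h1 := (summable_nat_add_iff 1).mpr (summable_norm_linCoeff hp a b)
  have h2 := summable_norm_quadCoeff hp a b
  have hsum := (h1.mul_right R).add (h2.mul_right (R ^ 2))
  refine ⟨(1 + ‖linCoeff a b p‖ * R) * Real.exp (∑' n : ℕ,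
    (‖linCoeff (a * p ^ (n + 1)) (b * p ^ (n + 1)) p‖ * R +
      ‖quadCoeff (a * p ^ n) (b * p ^ n) p‖ * R ^ 2)), fun n y hy => ?_⟩
  have hR : 0 ≤ R := (norm_nonneg y).trans hy
  refine norm_le_exp_of_recurrence (u := fun n => revPoly a b p n y)
    (s := fun n => linCoeff (a * p ^ (n + 1)) (b * p ^ (n + 1)) p * y)
    (t := fun n => quadCoeff (a * p ^ n) (b * p ^ n) p * y ^ 2)
    (fun n => rfl) ?_ ?_ (fun n => ?_) n
  · simp only [revPoly, norm_one]
    exact le_add_of_nonneg_right (by positivity)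
  · simp only [revPoly]
    refine (norm_add_le _ _).trans ?_
    rw [norm_one, norm_mul]
    gcongr
  · refine le_trans ?_ (hsum.sum_le_tsum (Finset.range n) fun i _ => by positivity)
    gcongr with i
    · rw [norm_mul]
      gcongr
    · rw [norm_mul, norm_pow]
      gcongr

lemma tendstoUniformlyOn_revPoly (hp : ‖p‖ < 1) {a b : ℂ} (ha : ‖a‖ < 1) (hb : ‖b‖ < 1) (R : ℝ) :
    TendstoUniformlyOn (revPoly a b p) (qLimit a b p) atTop (Metric.closedBall 0 R) := by
  set l : Filter (ℕ × ℂ) := atTop ×ˢ principal (Metric.closedBall 0 R)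
  have hR : ∀ᶠ i in l, ‖i.2‖ ≤ R := by
    have := (eventually_principal.mpr fun x hx => hx :
      ∀ᶠ x in principal (Metric.closedBall (0 : ℂ) R), x ∈ Metric.closedBall (0 : ℂ) R)
    filter_upwards [this.prod_inr atTop] with i hi using by simpa using hi
  obtain ⟨M, hM⟩ := exists_norm_revPoly_le hp a b R
  have hbdd (m : ℕ) : IsBoundedUnder (· ≤ ·) l
      ((‖·‖) ∘ fun i : ℕ × ℂ => revPoly a b p (i.1 + m) i.2) :=
    ⟨M, by simpa using hR.mono fun i hi => hM (i.1 + m) i.2 hi⟩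
  have hshift (m : ℕ) : Tendsto (fun i : ℕ × ℂ => (i.1 + m, i.2)) l l :=
    ((tendsto_add_atTop_nat m).comp tendsto_fst).prodMk tendsto_snd
  have hF (m : ℕ) := (tendsto_qLimit hp ha hb R).comp (hshift m)
  have hquad : Tendsto (fun i : ℕ × ℂ => quadCoeff (a * p ^ i.1) (b * p ^ i.1) p) l (nhds 0) :=
    (tendsto_zero_iff_norm_tendsto_zero.mpr
      (summable_norm_quadCoeff hp a b).tendsto_atTop_zero).comp tendsto_fst
  have hy2 : IsBoundedUnder (· ≤ ·) l ((‖·‖) ∘ fun i : ℕ × ℂ => i.2 ^ 2) := by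
    refine ⟨R ^ 2, ?_⟩
    rw [eventually_map]
    filter_upwards [hR] with i hi
    simp only [Function.comp_apply, norm_pow]
    gcongr
  have e1 : Tendsto (fun i : ℕ × ℂ => revPoly a b p (i.1 + 1) i.2 *
      (qLimit (a * p ^ (i.1 + 1)) (b * p ^ (i.1 + 1)) p i.2 - 1)) l (nhds 0) := by
    refine isBoundedUnder_le_mul_tendsto_zero (hbdd 1) ?_
    simpa [Function.comp_def] using (hF 1).sub_const 1
  have e2 := ((hquad.zero_mul_isBoundedUnder_le hy2).zero_mul_isBoundedUnder_le (hbdd 0)).mul (hF 2)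
  have e := e1.add e2
  simp only [Function.comp_def, add_zero, zero_mul] at e
  have hdiff : Tendsto (fun i : ℕ × ℂ => qLimit a b p i.2 - revPoly a b p (i.1 + 1) i.2) l
      (nhds 0) := by
    refine e.congr fun i => ?_
    rw [qLimit_eq_revPoly hp ha hb i.2 i.1]
    ring
  rw [Metric.tendstoUniformlyOn_iff]
  intro ε hε
  have hev := (Metric.tendsto_nhds.mp hdiff) ε hε
  rw [eventually_prod_principal_iff] at hev
  rw [← map_add_atTop_eq_nat 1, eventually_map]
  filter_upwards [hev] with n hn y hy
  simpa [dist_eq_norm] using hn y hy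

end Recurrence

section Transfer

lemma rpw_add {p : ℝ} (hp : 0 < p) (s t : ℝ) : rpw p (s + t) = rpw p s * rpw p t := by
  simp [rpw, Real.rpow_add hp]

lemma rpw_natCast (p : ℝ) (n : ℕ) : rpw p n = (p : ℂ) ^ n := by
  simp [rpw]

lemma rpw_mul_natCast {p : ℝ} (hp : 0 < p) (s : ℝ) (n : ℕ) : rpw p (s * n) = rpw p s ^ n := by
  simp [rpw, Real.rpow_mul hp.le]

lemma norm_rpw_lt_one {p : ℝ} (hp0 : 0 < p) (hp1 : p < 1) {s : ℝ} (hs : 0 < s) :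
    ‖rpw p s‖ < 1 := by
  rw [rpw, Complex.norm_real, Real.norm_of_nonneg (Real.rpow_nonneg hp0.le s)]
  exact Real.rpow_lt_one hp0.le hp1 hs

lemma rpw_half_sq {p : ℝ} (hp : 0 < p) : rpw p (1 / 2) ^ 2 = p := by
  rw [← rpw_mul_natCast hp]
  norm_num [rpw]

lemma rpw_add_add_two_mul {p : ℝ} (hp : 0 < p) (α β : ℝ) (m k : ℕ) :
    rpw p (α + β + 2 + m + 2 * (k : ℝ)) =
      rpw p (α + 1) * (p : ℂ) ^ k * (rpw p (β + 1) * (p : ℂ) ^ k) * (p : ℂ) ^ m := by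
  rw [show α + β + 2 + m + 2 * (k : ℝ) = (α + 1) + k + ((β + 1) + k) + m by ring]
  simp only [rpw_add hp _ (Nat.cast _), rpw_add hp (α + 1 + _), rpw_natCast]

lemma Aterm_eq {p : ℝ} (hp : 0 < p) (α β : ℝ) (k : ℕ) :
    Aterm p α β k =
      linCoeff (rpw p (α + 1) * (p : ℂ) ^ k) (rpw p (β + 1) * (p : ℂ) ^ k) p *
        rpw p (1 / 2) := by
  have e0 := rpw_add_add_two_mul hp α β 0 k
  have e1 := rpw_add_add_two_mul hp α β 1 k
  have e2 := rpw_add_add_two_mul hp α β 2 k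
  have e3 : rpw p (α + 3 / 2 + (k : ℝ)) = rpw p (α + 1) * (p : ℂ) ^ k * rpw p (1 / 2) := by
    rw [← rpw_natCast, ← rpw_add hp, ← rpw_add hp]
    ring_nf
  have e4 : rpw p (β - α) * rpw p (α + 1) = rpw p (β + 1) := by
    rw [← rpw_add hp]
    ring_nf
  rw [show α + β + 2 + ((0 : ℕ) : ℝ) + 2 * (k : ℝ) = α + β + 2 + 2 * k by simp, pow_zero,
    mul_one] at e0
  rw [show α + β + 2 + ((1 : ℕ) : ℝ) + 2 * (k : ℝ) = α + β + 3 + 2 * k by push_cast; ring,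
    pow_one] at e1
  rw [show α + β + 2 + ((2 : ℕ) : ℝ) + 2 * (k : ℝ) = α + β + 4 + 2 * k by push_cast; ring] at e2
  rw [Aterm, linCoeff, e0, e1, e2, e3, ← e4]
  ring

lemma Cterm_succ_eq {p : ℝ} (hp : 0 < p) (α β : ℝ) (k : ℕ) :
    Cterm p α β (k + 1) =
      quadCoeff (rpw p (α + 1) * (p : ℂ) ^ k) (rpw p (β + 1) * (p : ℂ) ^ k) p *
        rpw p (1 / 2) ^ 2 := by
  have e1 := rpw_add_add_two_mul hp α β 1 k
  have e2 := rpw_add_add_two_mul hp α β 2 k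
  have e3 := rpw_add_add_two_mul hp α β 3 k
  have hsq (s : ℝ) : rpw p (2 * s + 2 + 2 * ((k + 1 : ℕ) : ℝ)) =
      (rpw p (s + 1) * (p : ℂ) ^ k) ^ 2 * (p : ℂ) ^ 2 := by
    rw [← mul_pow, ← rpw_natCast, ← rpw_add hp, ← pow_one (p : ℂ), ← rpw_natCast, ← rpw_add hp,
      ← rpw_mul_natCast hp]
    push_cast
    ring_nf
  rw [show α + β + 2 + ((1 : ℕ) : ℝ) + 2 * (k : ℝ) = α + β + 1 + 2 * ((k + 1 : ℕ) : ℝ) by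
    push_cast; ring, pow_one] at e1
  rw [show α + β + 2 + ((2 : ℕ) : ℝ) + 2 * (k : ℝ) = α + β + 2 + 2 * ((k + 1 : ℕ) : ℝ) by
    push_cast; ring] at e2
  rw [show α + β + 2 + ((3 : ℕ) : ℝ) + 2 * (k : ℝ) = α + β + 3 + 2 * ((k + 1 : ℕ) : ℝ) by
    push_cast; ring] at e3
  rw [Cterm, quadCoeff, e1, e2, e3, hsq, hsq, rpw_half_sq hp]
  ring

lemma pow_mul_bpoly_eq_revPoly {p : ℝ} (hp : 0 < p) (α β : ℝ) {x : ℂ} (hx : x ≠ 0) :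
    ∀ n, x ^ n * bpoly p α β n (1 / x) =
      revPoly (rpw p (α + 1)) (rpw p (β + 1)) p n (rpw p (1 / 2) * x)
  | 0 => by simp [bpoly, revPoly]
  | 1 => by
    have h := Aterm_eq hp α β 0
    simp only [pow_zero, mul_one] at h
    rw [bpoly, revPoly, h]
    field_simp
  | n + 2 => by
    simp only [revPoly, bpoly]
    rw [← pow_mul_bpoly_eq_revPoly hp α β hx n, ← pow_mul_bpoly_eq_revPoly hp α β hx (n + 1),
      Aterm_eq hp, Cterm_succ_eq hp]
    field_simp
    ring

lemma continuous_revPoly (a b p : ℂ) : ∀ n, Continuous (revPoly a b p n)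
  | 0 => continuous_const
  | 1 => by
    unfold revPoly
    fun_prop
  | n + 2 => by
    have h0 := continuous_revPoly a b p n
    have h1 := continuous_revPoly a b p (n + 1)
    unfold revPoly
    fun_prop

end Transfer

theorem statement4 (q α β : ℝ) (hq0 : 0 < q) (hq1 : q < 1)
    (hα : -1 < α) (hβ : -1 < β)
    (p : ℝ) (hp : p = q ^ ((1 : ℝ)/2))
    (Q : ℕ → Polynomial ℂ)
    (hQ : ∀ n : ℕ, ∀ x : ℂ, x ≠ 0 → (Q n).eval x = x^n * bpoly p α β n (1/x))
    (F : ℂ → ℂ)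
    (hF : ∀ x : ℂ, F x =
      (qPochInf (rpw p (β + 1)) (p : ℂ) / qPochInf (rpw p (α + β + 2)) (p : ℂ)) *
      ∑' k : ℕ,
        (qPoch (rpw p (α + 1)) (p : ℂ) k * qPoch (rpw p (1/2) * x) (p : ℂ) k /
          qPoch (p : ℂ) (p : ℂ) k) *
        qPochInf (-(rpw p (α + 3/2 + (k : ℝ))) * x) (p : ℂ) * rpw p ((β + 1) * (k : ℝ))) :
    ∀ K : Set ℂ, IsCompact K →
      TendstoUniformlyOn (fun n x => (Q n).eval x) F Filter.atTop K := by
  have hp0 : 0 < p := hp ▸ Real.rpow_pos_of_pos hq0 _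
  have hp1 : p < 1 := hp ▸ Real.rpow_lt_one hq0.le hq1 (by norm_num)
  have hpn : ‖(p : ℂ)‖ < 1 := by
    rwa [Complex.norm_real, Real.norm_of_nonneg hp0.le]
  have hQrev (n : ℕ) (x : ℂ) : (Q n).eval x =
      revPoly (rpw p (α + 1)) (rpw p (β + 1)) p n (rpw p (1 / 2) * x) := by
    refine congrFun (Continuous.ext_on (dense_compl_singleton (0 : ℂ)) (Q n).continuous
      ((continuous_revPoly _ _ _ n).comp (continuous_const.mul continuous_id)) fun z hz => ?_) x
    exact (hQ n z hz).trans (pow_mul_bpoly_eq_revPoly hp0 α β hz n)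
  have hFlim (x : ℂ) :
      F x = qLimit (rpw p (α + 1)) (rpw p (β + 1)) p (rpw p (1 / 2) * x) := by
    have hab : rpw p (α + β + 2) = rpw p (α + 1) * rpw p (β + 1) := by
      rw [← rpw_add hp0]
      ring_nf
    have hak (k : ℕ) : -rpw p (α + 3 / 2 + (k : ℝ)) * x =
        -(rpw p (α + 1) * (rpw p (1 / 2) * x) * (p : ℂ) ^ k) := by
      rw [show α + 3 / 2 + (k : ℝ) = α + 1 + 1 / 2 + k by ring, rpw_add hp0, rpw_add hp0,
        rpw_natCast]
      ring
    simp only [hF, qLimit, qTerm, hab, hak, rpw_mul_natCast hp0]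
  intro K hK
  obtain ⟨R, hR⟩ := hK.isBounded.exists_norm_le
  have h := (tendstoUniformlyOn_revPoly hpn (norm_rpw_lt_one hp0 hp1 (by linarith : 0 < α + 1))
    (norm_rpw_lt_one hp0 hp1 (by linarith : 0 < β + 1)) (‖rpw p (1 / 2)‖ * R)).comp
    fun x => rpw p (1 / 2) * x
  refine ((h.mono fun x hx => ?_).congr (.of_forall fun n x _ => (hQrev n x).symm)).congr_right
    fun x _ => (hFlim x).symm
  simpa using mul_le_mul_of_nonneg_left (hR x hx) (norm_nonneg (rpw p (1 / 2)))
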